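/- Let Φ_k be a homogeneous polynomial of degree k in m₀ variables with coefficients in H^ℓ(ℝ/Tℤ, ℝ^m) and N_p a homogeneous polynomial of degree p with coefficients in H^ℓ(ℝ/Tℤ, ℝ^{m₀}). Then the directional derivative D_X Φ_k(X,t)·N_p(X,t), a homogeneous polynomial of degree k−1+p, satisfies ‖D_X Φ_k · N_p‖_{k−1+p} ≤ C k √{m₀} ‖Φ_k‖_k ‖N_p‖_p, where C is the algebra constant of H^ℓ. -/

import Mathlib

open MeasureTheory
open scoped BigOperators

/-- Sobolev `H^ℓ` norm of a `T`-periodic function, via Fourier coefficients. -/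
noncomputable def HsNorm (T : ℝ) [Fact (0 < T)] (ℓ : ℕ) {E : Type}
    [NormedAddCommGroup E] [NormedSpace ℂ E] (f : AddCircle T → E) : ℝ :=
  Real.sqrt (∑' k : ℤ, (1 + (k : ℝ) ^ 2) ^ ℓ * ‖fourierCoeff f k‖ ^ 2)

/-- `f` belongs to the Sobolev space `H^ℓ(ℝ/Tℤ, E)`. -/
def MemHs (T : ℝ) [Fact (0 < T)] (ℓ : ℕ) {E : Type}
    [NormedAddCommGroup E] [NormedSpace ℂ E] (f : AddCircle T → E) : Prop :=
  Integrable f AddCircle.haarAddCircle ∧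
    Summable (fun k : ℤ => (1 + (k : ℝ) ^ 2) ^ ℓ * ‖fourierCoeff f k‖ ^ 2)

section Fourier

open AddCircle Filter Topology

variable {T : ℝ}

theorem integral_continuousMap_mul_eq_zero [Fact (0 < T)] {h : AddCircle T → ℂ}
    (hh : Integrable h haarAddCircle) (h0 : ∀ n, fourierCoeff h n = 0) (g : C(AddCircle T, ℂ)) :
    ∫ t, g t * h t ∂haarAddCircle = 0 := by
  have hint : ∀ g : C(AddCircle T, ℂ), Integrable (fun t => g t * h t) haarAddCircle := fun g =>
    hh.bdd_mul g.continuous.aestronglyMeasurable (ae_of_all _ fun t => g.norm_coe_le_norm t)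
  let L : C(AddCircle T, ℂ) →L[ℂ] ℂ := LinearMap.mkContinuous
    { toFun := fun g => ∫ t, g t * h t ∂haarAddCircle
      map_add' := fun g₁ g₂ => by
        simp only [ContinuousMap.add_apply, add_mul]
        exact integral_add (hint g₁) (hint g₂)
      map_smul' := fun c g => by
        simp only [ContinuousMap.smul_apply, smul_eq_mul, mul_assoc, RingHom.id_apply]
        exact integral_const_mul _ _ }
    (∫ t, ‖h t‖ ∂haarAddCircle) (fun g => by
      refine (norm_integral_le_integral_norm _).trans ?_
      rw [mul_comm, ← integral_const_mul]
      refine integral_mono (hint g).norm (hh.norm.const_mul _) fun t => ?_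
      simp only [norm_mul]
      exact mul_le_mul_of_nonneg_right (g.norm_coe_le_norm t) (norm_nonneg _))
  have hle : (Submodule.span ℂ (Set.range (@fourier T))).topologicalClosure ≤ L.ker := by
    refine Submodule.topologicalClosure_minimal _ (Submodule.span_le.2 ?_) L.isClosed_ker
    rintro _ ⟨n, rfl⟩
    have := h0 (-n)
    rw [fourierCoeff, neg_neg] at this
    exact this
  rw [span_fourier_closure_eq_top] at hle
  exact hle (Submodule.mem_top (x := g))

/-- An integrable function on the circle is determined a.e. by its Fourier coefficients. -/
theorem ae_eq_zero_of_fourierCoeff_eq_zero [Fact (0 < T)] {h : AddCircle T → ℂ}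
    (hh : Integrable h haarAddCircle) (h0 : ∀ n, fourierCoeff h n = 0) :
    h =ᵐ[haarAddCircle] 0 := by
  refine ae_eq_zero_of_forall_setIntegral_isClosed_eq_zero hh fun s hs => ?_
  have hlim : Tendsto (fun n => ∫ t, ((hs.apprSeq n t : ℝ) : ℂ) * h t ∂haarAddCircle) atTop
      (𝓝 (∫ t, s.indicator h t ∂haarAddCircle)) := by
    refine tendsto_integral_of_dominated_convergence (fun t => ‖h t‖) (fun n => ?_) hh.norm
      (fun n => ae_of_all _ fun t => ?_) (ae_of_all _ fun t => ?_)
    · refine AEStronglyMeasurable.mul ?_ hh.1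
      exact Continuous.aestronglyMeasurable (by fun_prop)
    · rw [norm_mul]
      refine mul_le_of_le_one_left (norm_nonneg _) ?_
      simpa using HasOuterApproxClosed.apprSeq_apply_le_one hs n t
    · have h1 := tendsto_pi_nhds.1 (HasOuterApproxClosed.tendsto_apprSeq hs) t
      have h2 : Tendsto (fun n => ((hs.apprSeq n t : ℝ) : ℂ)) atTop
          (𝓝 (((s.indicator (fun _ => (1 : NNReal)) t : NNReal) : ℝ) : ℂ)) :=
        (Complex.continuous_ofReal.tendsto _).comp ((NNReal.continuous_coe.tendsto _).comp h1)
      convert h2.mul_const (h t) using 2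
      by_cases ht : t ∈ s <;> simp [ht]
  have hzero : ∀ n, ∫ t, ((hs.apprSeq n t : ℝ) : ℂ) * h t ∂haarAddCircle = 0 := fun n =>
    integral_continuousMap_mul_eq_zero hh h0
      ⟨fun t => ((hs.apprSeq n t : ℝ) : ℂ), by fun_prop⟩
  simp only [hzero] at hlim
  rw [← integral_indicator hs.measurableSet]
  exact tendsto_nhds_unique hlim tendsto_const_nhds

theorem summable_mul_fourier {c : ℤ → ℂ} (hc : Summable fun j => ‖c j‖) (t : AddCircle T) :
    Summable fun j => c j * fourier j t := by
  refine Summable.of_norm ?_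
  simpa only [norm_mul, fourier_apply, Circle.norm_coe, mul_one] using hc

theorem continuous_tsum_mul_fourier {c : ℤ → ℂ} (hc : Summable fun j => ‖c j‖) :
    Continuous fun t : AddCircle T => ∑' j, c j * fourier j t := by
  refine continuous_tsum (fun j => by fun_prop) hc fun j t => ?_
  simp only [norm_mul, fourier_apply, Circle.norm_coe, mul_one, le_refl]

theorem norm_tsum_mul_fourier_le {c : ℤ → ℂ} (hc : Summable fun j => ‖c j‖) (t : AddCircle T) :
    ‖∑' j, c j * fourier j t‖ ≤ ∑' j, ‖c j‖ := by
  refine tsum_of_norm_bounded hc.hasSum fun j => ?_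
  simp only [norm_mul, fourier_apply, Circle.norm_coe, mul_one, le_refl]

variable [Fact (0 < T)] {E : Type} [NormedAddCommGroup E] [NormedSpace ℂ E]

theorem integrable_tsum_mul_fourier_smul {c : ℤ → ℂ} (hc : Summable fun j => ‖c j‖)
    {g : AddCircle T → E} (hg : Integrable g haarAddCircle) :
    Integrable (fun t => (∑' j, c j * fourier j t) • g t) haarAddCircle :=
  hg.bdd_smul _ (continuous_tsum_mul_fourier hc).aestronglyMeasurable
    (ae_of_all _ fun t => norm_tsum_mul_fourier_le hc t)

theorem hasSum_fourierCoeff_tsum_mul_fourier_smul {c : ℤ → ℂ} (hc : Summable fun j => ‖c j‖)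
    {g : AddCircle T → E} (hg : Integrable g haarAddCircle) (n : ℤ) :
    HasSum (fun j => c j • fourierCoeff g (n - j))
      (fourierCoeff (fun t => (∑' j, c j * fourier j t) • g t) n) := by
  have hF : ∀ (j : ℤ) (t : AddCircle T),
      fourier (-n) t • ((c j * fourier j t) • g t) = c j • (fourier (-(n - j)) t • g t) := by
    intro j t
    rw [neg_sub, sub_eq_add_neg, fourier_add, smul_smul, smul_smul]
    ring_nf
  have h := hasSum_integral_of_summable_integral_norm (μ := haarAddCircle)
    (F := fun (j : ℤ) (t : AddCircle T) => fourier (-n) t • ((c j * fourier j t) • g t))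
    (fun j => by
      simp only [hF]
      exact (hg.fourier_smul _).smul (c j))
    (by
      simp only [norm_smul, norm_mul, fourier_apply, Circle.norm_coe, one_mul, mul_one,
        integral_const_mul]
      exact hc.mul_right _)
  convert h using 1
  · funext j
    simp only [hF, integral_smul, fourierCoeff]
  · rw [fourierCoeff]
    refine integral_congr_ae (ae_of_all _ fun t => ?_)
    have hs := (summable_mul_fourier hc t).hasSum.smul_const (g t)
    exact ((hs.const_smul (fourier (-n) t)).tsum_eq).symm

theorem ae_eq_tsum_fourierCoeff {f : AddCircle T → ℂ} (hf : Integrable f haarAddCircle)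
    (hc : Summable fun j => ‖fourierCoeff f j‖) :
    f =ᵐ[haarAddCircle] fun t => ∑' j, fourierCoeff f j * fourier j t := by
  have hone : Integrable (fun _ : AddCircle T => (1 : ℂ)) haarAddCircle := integrable_const _
  have hI := integrable_tsum_mul_fourier_smul hc hone
  have hco := hasSum_fourierCoeff_tsum_mul_fourier_smul hc hone
  simp only [smul_eq_mul, mul_one] at hI hco
  have h1 : ∀ n, fourierCoeff (fun _ : AddCircle T => (1 : ℂ)) n =
      Pi.single (M := fun _ => ℂ) 0 1 n := by
    intro n
    have h := congrFun (fourierCoeff_fourier (T := T) 0) n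
    rw [← h]
    congr 1
    funext t
    simp
  have h2 : ∀ n, fourierCoeff (fun t : AddCircle T => ∑' j, fourierCoeff f j * fourier j t) n =
      fourierCoeff f n := by
    intro n
    refine (hco n).unique ?_
    have h3 := hasSum_single (f := fun j =>
      fourierCoeff f j * fourierCoeff (fun _ : AddCircle T => (1 : ℂ)) (n - j)) n
      (fun j hj => by
        rw [h1, Pi.single_eq_of_ne (sub_ne_zero.2 hj.symm), mul_zero])
    simpa [h1] using h3
  have h4 := ae_eq_zero_of_fourierCoeff_eq_zero (hf.sub hI) (fun n => by
    have h5 := fourierCoeff.add hf (hI.neg)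
    have h6 := fourierCoeff.const_smul
      (fun t : AddCircle T => ∑' j, fourierCoeff f j * fourier j t) (-1) n
    rw [sub_eq_add_neg, h5, Pi.add_apply]
    rw [neg_one_smul, neg_one_smul, h2] at h6
    rw [h6, add_neg_cancel])
  filter_upwards [h4] with t ht
  exact sub_eq_zero.1 ht

end Fourier

section Sobolev

open AddCircle

variable {T : ℝ} [Fact (0 < T)] {ℓ : ℕ} {E : Type} [NormedAddCommGroup E] [NormedSpace ℂ E]

theorem summable_inv_one_add_sq_pow (hℓ : 1 ≤ ℓ) :
    Summable fun n : ℤ => ((1 + (n : ℝ) ^ 2) ^ ℓ)⁻¹ := by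
  have h1 : Summable fun n : ℤ => 1 / (n : ℝ) ^ 2 := Real.summable_one_div_int_pow.2 one_lt_two
  refine Summable.of_norm_bounded_eventually h1 ?_
  filter_upwards [(Set.finite_singleton (0 : ℤ)).compl_mem_cofinite] with n hn
  have hn' : (n : ℝ) ≠ 0 := by exact_mod_cast hn
  have h2 : 0 < (n : ℝ) ^ 2 := by positivity
  rw [Real.norm_of_nonneg (by positivity), one_div]
  refine inv_anti₀ h2 ?_
  calc (n : ℝ) ^ 2 ≤ (1 + (n : ℝ) ^ 2) ^ 1 := by linarith
    _ ≤ _ := pow_le_pow_right₀ (by linarith) hℓ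

theorem MemHs.summable_norm_fourierCoeff (hℓ : 1 ≤ ℓ) {f : AddCircle T → E} (hf : MemHs T ℓ f) :
    Summable fun n => ‖fourierCoeff f n‖ := by
  refine Summable.of_nonneg_of_le (fun _ => norm_nonneg _) (fun n => ?_)
    ((summable_inv_one_add_sq_pow hℓ).add hf.2)
  have hw : 0 < (1 + (n : ℝ) ^ 2) ^ ℓ := by positivity
  generalize (1 + (n : ℝ) ^ 2) ^ ℓ = w at *
  generalize ‖fourierCoeff f n‖ = x
  have h : w⁻¹ + w * x ^ 2 - x = w⁻¹ * ((w * x - 1 / 2) ^ 2 + 3 / 4) := by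
    field_simp
    ring
  have : 0 ≤ w⁻¹ * ((w * x - 1 / 2) ^ 2 + 3 / 4) := by positivity
  linarith

theorem sq_tsum_mul_le {ι : Type*} {u v : ι → ℝ} (hu : ∀ i, 0 ≤ u i) (hv : ∀ i, 0 ≤ v i)
    (hu2 : Summable fun i => u i ^ 2) (hv2 : Summable fun i => v i ^ 2) :
    Summable (fun i => u i * v i) ∧
      (∑' i, u i * v i) ^ 2 ≤ (∑' i, u i ^ 2) * ∑' i, v i ^ 2 := by
  have h := Real.summable_and_inner_le_Lp_mul_Lq_tsum_of_nonneg Real.HolderConjugate.two_two hu hv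
    (by simpa using hu2) (by simpa using hv2)
  refine ⟨h.1, ?_⟩
  have h2 := h.2
  simp only [Real.rpow_two, ← Real.sqrt_eq_rpow] at h2
  rw [← Real.sqrt_mul (tsum_nonneg fun i => sq_nonneg _)] at h2
  have h3 : 0 ≤ (∑' i, u i ^ 2) * ∑' i, v i ^ 2 :=
    mul_nonneg (tsum_nonneg fun i => sq_nonneg _) (tsum_nonneg fun i => sq_nonneg _)
  calc _ ≤ _ := pow_le_pow_left₀ (tsum_nonneg fun i => mul_nonneg (hu i) (hv i)) h2 2
    _ = _ := Real.sq_sqrt h3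

theorem one_add_sq_pow_le (ℓ : ℕ) (n j : ℤ) :
    (1 + (n : ℝ) ^ 2) ^ ℓ ≤
      4 ^ ℓ * ((1 + (j : ℝ) ^ 2) ^ ℓ + (1 + ((n - j : ℤ) : ℝ) ^ 2) ^ ℓ) := by
  set x := 1 + (j : ℝ) ^ 2
  set y := 1 + ((n - j : ℤ) : ℝ) ^ 2
  have hx : 0 ≤ x := by positivity
  have hy : 0 ≤ y := by positivity
  have h1 : 1 + (n : ℝ) ^ 2 ≤ 4 * max x y := by
    have h : (n : ℝ) = j + ((n - j : ℤ) : ℝ) := by push_cast; ring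
    have h2 : 1 + (n : ℝ) ^ 2 ≤ 2 * x + 2 * y := by
      simp only [x, y]
      generalize ((n - j : ℤ) : ℝ) = z at h
      rw [h]
      nlinarith [sq_nonneg ((j : ℝ) - z)]
    linarith [le_max_left x y, le_max_right x y]
  calc _ ≤ (4 * max x y) ^ ℓ := pow_le_pow_left₀ (by positivity) h1 ℓ
    _ = 4 ^ ℓ * (max x y) ^ ℓ := mul_pow _ _ _
    _ ≤ _ := by
      gcongr
      rcases max_choice x y with h | h <;> rw [h]
      · exact le_add_of_nonneg_right (by positivity)
      · exact le_add_of_nonneg_left (by positivity)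

/-- A weighted `ℓ²` convolution estimate, for weights `w` with summable inverse which are
subadditive up to a constant. -/
theorem summable_mul_sq_of_hasSum_conv {w : ℤ → ℝ} {K : ℝ} (hK : 0 ≤ K) (hw : ∀ n, 0 < w n)
    (hwK : ∀ n j, w n ≤ K * (w j + w (n - j))) (hwi : Summable fun n => (w n)⁻¹)
    {c : ℤ → ℂ} {d r : ℤ → E} (hr : ∀ n, HasSum (fun j => c j • d (n - j)) (r n))
    (hc : Summable fun n => w n * ‖c n‖ ^ 2) (hd : Summable fun n => w n * ‖d n‖ ^ 2) :
    Summable fun n => w n * ‖r n‖ ^ 2 := by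
  have hc0 : ∀ n, 0 ≤ w n * ‖c n‖ ^ 2 := fun n => mul_nonneg (hw n).le (sq_nonneg _)
  have hd0 : ∀ n, 0 ≤ w n * ‖d n‖ ^ 2 := fun n => mul_nonneg (hw n).le (sq_nonneg _)
  let e : ℤ × ℤ ≃ ℤ × ℤ :=
    { toFun := fun q => (q.2, q.1 - q.2)
      invFun := fun q => (q.1 + q.2, q.1)
      left_inv := fun q => by simp
      right_inv := fun q => by simp }
  obtain ⟨A, hA⟩ : ∃ A : ℤ → ℝ, ∀ n, A n = w n * ‖c n‖ ^ 2 := ⟨_, fun _ => rfl⟩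
  obtain ⟨B, hB⟩ : ∃ B : ℤ → ℝ, ∀ n, B n = w n * ‖d n‖ ^ 2 := ⟨_, fun _ => rfl⟩
  simp only [← hA] at hc hc0
  simp only [← hB] at hd hd0
  have hAB : Summable fun q : ℤ × ℤ => A q.2 * B (q.1 - q.2) :=
    e.summable_iff.2 (hc.mul_of_nonneg hd hc0 hd0)
  have hconv := (summable_prod_of_nonneg fun q => mul_nonneg (hc0 _) (hd0 _)).1 hAB
  obtain ⟨S, hS⟩ := hwi
  refine Summable.of_nonneg_of_le (fun n => mul_nonneg (hw n).le (sq_nonneg _)) (fun n => ?_)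
    (hconv.2.mul_left (K * (S + S)))
  have hS' : HasSum (fun j => K * ((w j)⁻¹ + (w (n - j))⁻¹)) (K * (S + S)) :=
    (hS.add ((Equiv.subLeft n).hasSum_iff.2 hS)).mul_left K
  have hu0 : ∀ j, 0 ≤ K * ((w j)⁻¹ + (w (n - j))⁻¹) := fun j =>
    mul_nonneg hK (add_nonneg (inv_nonneg.2 (hw _).le) (inv_nonneg.2 (hw _).le))
  have hv0 : ∀ j, 0 ≤ A j * B (n - j) := fun j => mul_nonneg (hc0 _) (hd0 _)
  have hcs := sq_tsum_mul_le (u := fun j => √(K * ((w j)⁻¹ + (w (n - j))⁻¹)))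
    (v := fun j => √(A j * B (n - j))) (fun _ => Real.sqrt_nonneg _) (fun _ => Real.sqrt_nonneg _)
    (by simpa only [Real.sq_sqrt (hu0 _)] using hS'.summable)
    (by simpa only [Real.sq_sqrt (hv0 _)] using hconv.1 n)
  simp only [Real.sq_sqrt (hu0 _), Real.sq_sqrt (hv0 _), hS'.tsum_eq] at hcs
  have hterm : ∀ j, ‖c j • d (n - j)‖ ≤
      (√(w n))⁻¹ * (√(K * ((w j)⁻¹ + (w (n - j))⁻¹)) * √(A j * B (n - j))) := by
    intro j
    rw [le_inv_mul_iff₀ (Real.sqrt_pos.2 (hw n)), ← Real.sqrt_mul (hu0 j)]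
    refine Real.le_sqrt_of_sq_le ?_
    rw [mul_pow, Real.sq_sqrt (hw n).le, norm_smul, mul_pow]
    have hj := (hw j).ne'
    have hnj := (hw (n - j)).ne'
    have h2 : K * ((w j)⁻¹ + (w (n - j))⁻¹) * (A j * B (n - j)) =
        K * (w j + w (n - j)) * (‖c j‖ ^ 2 * ‖d (n - j)‖ ^ 2) := by
      rw [hA, hB]
      field_simp
      ring
    rw [h2]
    exact mul_le_mul_of_nonneg_right (hwK n j) (by positivity)
  have hnorm := tsum_of_norm_bounded (hcs.1.hasSum.mul_left (√(w n))⁻¹) hterm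
  rw [(hr n).tsum_eq, le_inv_mul_iff₀ (Real.sqrt_pos.2 (hw n))] at hnorm
  have h := (pow_le_pow_left₀ (mul_nonneg (Real.sqrt_nonneg _) (norm_nonneg _)) hnorm 2).trans
    hcs.2
  rwa [mul_pow, Real.sq_sqrt (hw n).le] at h

/-- `H^ℓ` with `ℓ ≥ 1` is closed under multiplication by scalar functions in `H^ℓ`. -/
theorem MemHs.smul (hℓ : 1 ≤ ℓ) {f : AddCircle T → ℂ} {g : AddCircle T → E}
    (hf : MemHs T ℓ f) (hg : MemHs T ℓ g) : MemHs T ℓ fun t => f t • g t := by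
  have hc := hf.summable_norm_fourierCoeff hℓ
  have hae : (fun t => f t • g t) =ᵐ[haarAddCircle]
      fun t => (∑' j, fourierCoeff f j * fourier j t) • g t := by
    filter_upwards [ae_eq_tsum_fourierCoeff hf.1 hc] with t ht
    rw [ht]
  refine ⟨(integrable_tsum_mul_fourier_smul hc hg.1).congr hae.symm, ?_⟩
  have hco := hasSum_fourierCoeff_tsum_mul_fourier_smul hc hg.1
  rw [← fourierCoeff_congr_ae hae] at hco
  exact summable_mul_sq_of_hasSum_conv (w := fun n : ℤ => (1 + (n : ℝ) ^ 2) ^ ℓ) (K := 4 ^ ℓ)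
    (by positivity) (fun n => by positivity) (one_add_sq_pow_le ℓ)
    (summable_inv_one_add_sq_pow hℓ) hco hf.2 hg.2

/-- The sequence of weighted Fourier coefficients, whose `ℓ²` norm is the `H^ℓ` norm. -/
theorem MemHs.exists_lp {f : AddCircle T → E} (hf : MemHs T ℓ f) :
    ∃ x : lp (fun _ : ℤ => E) 2,
      (∀ n, x n = ((√((1 + (n : ℝ) ^ 2) ^ ℓ) : ℝ) : ℂ) • fourierCoeff f n) ∧
        ‖x‖ = HsNorm T ℓ f := by
  have hsq : ∀ n : ℤ, ‖((√((1 + (n : ℝ) ^ 2) ^ ℓ) : ℝ) : ℂ) • fourierCoeff f n‖ ^ 2 =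
      (1 + (n : ℝ) ^ 2) ^ ℓ * ‖fourierCoeff f n‖ ^ 2 := by
    intro n
    rw [norm_smul, Complex.norm_real, Real.norm_of_nonneg (Real.sqrt_nonneg _), mul_pow,
      Real.sq_sqrt (by positivity)]
  have hmem : Memℓp (fun n : ℤ => ((√((1 + (n : ℝ) ^ 2) ^ ℓ) : ℝ) : ℂ) • fourierCoeff f n) 2 := by
    refine memℓp_gen ?_
    simpa only [ENNReal.toReal_ofNat, Real.rpow_two, hsq] using hf.2
  refine ⟨⟨_, hmem⟩, fun n => rfl, ?_⟩
  rw [lp.norm_eq_tsum_rpow (by norm_num), HsNorm, Real.sqrt_eq_rpow]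
  simp only [ENNReal.toReal_ofNat, Real.rpow_two, hsq]

theorem HsNorm_nonneg (f : AddCircle T → E) : 0 ≤ HsNorm T ℓ f := Real.sqrt_nonneg _

theorem HsNorm_sq (f : AddCircle T → E) :
    HsNorm T ℓ f ^ 2 = ∑' n : ℤ, (1 + (n : ℝ) ^ 2) ^ ℓ * ‖fourierCoeff f n‖ ^ 2 :=
  Real.sq_sqrt (tsum_nonneg fun n => by positivity)

theorem HsNorm_sum_smul_le {ι : Type*} (s : Finset ι) (c : ι → ℂ) {f : ι → AddCircle T → E}
    (hf : ∀ i ∈ s, MemHs T ℓ (f i)) :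
    HsNorm T ℓ (fun t => ∑ i ∈ s, c i • f i t) ≤ ∑ i ∈ s, ‖c i‖ * HsNorm T ℓ (f i) := by
  choose! x hx hxn using fun i hi => (hf i hi).exists_lp
  have hco : ∀ n, fourierCoeff (fun t => ∑ i ∈ s, c i • f i t) n =
      ∑ i ∈ s, c i • fourierCoeff (f i) n := by
    intro n
    have h := congrFun (fourierCoeff.sum s (fun i => c i • f i) fun i hi => (hf i hi).1.smul _) n
    simp only [Finset.sum_apply, fourierCoeff.const_smul] at h
    rw [← h]
    congr 1
    funext t
    simp
  have hnorm : HsNorm T ℓ (fun t => ∑ i ∈ s, c i • f i t) = ‖∑ i ∈ s, c i • x i‖ := by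
    rw [lp.norm_eq_tsum_rpow (by norm_num), HsNorm, Real.sqrt_eq_rpow]
    simp only [ENNReal.toReal_ofNat, Real.rpow_two]
    congr 1
    refine tsum_congr fun n => ?_
    have h : (∑ i ∈ s, c i • x i : lp (fun _ : ℤ => E) 2) n =
        ((√((1 + (n : ℝ) ^ 2) ^ ℓ) : ℝ) : ℂ) • fourierCoeff (fun t => ∑ i ∈ s, c i • f i t) n := by
      rw [hco, Finset.smul_sum, lp.coeFn_sum, Finset.sum_apply]
      refine Finset.sum_congr rfl fun i hi => ?_
      rw [lp.coeFn_smul, Pi.smul_apply, hx i hi, smul_comm]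
    rw [h, norm_smul, Complex.norm_real, Real.norm_of_nonneg (Real.sqrt_nonneg _), mul_pow,
      Real.sq_sqrt (by positivity)]
  rw [hnorm]
  refine (norm_sum_le _ _).trans (Finset.sum_le_sum fun i hi => ?_)
  rw [norm_smul, hxn i hi]

variable {ι : Type} [Fintype ι] {f : AddCircle T → EuclideanSpace ℂ ι}

theorem fourierCoeff_euclidean_apply (hf : Integrable f haarAddCircle) (i : ι) (n : ℤ) :
    fourierCoeff (fun t => f t i) n = fourierCoeff f n i := by
  have h := (EuclideanSpace.proj i : EuclideanSpace ℂ ι →L[ℂ] ℂ).integral_comp_comm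
    (hf.fourier_smul (-n))
  simpa [fourierCoeff] using h

theorem MemHs.euclidean_apply (hf : MemHs T ℓ f) (i : ι) : MemHs T ℓ fun t => f t i := by
  refine ⟨(EuclideanSpace.proj i : EuclideanSpace ℂ ι →L[ℂ] ℂ).integrable_comp hf.1, ?_⟩
  refine Summable.of_nonneg_of_le (fun n => by positivity) (fun n => ?_) hf.2
  rw [fourierCoeff_euclidean_apply hf.1]
  gcongr
  exact PiLp.norm_apply_le _ _

theorem MemHs.sum_sq_HsNorm_apply (hf : MemHs T ℓ f) :
    ∑ i, HsNorm T ℓ (fun t => f t i) ^ 2 = HsNorm T ℓ f ^ 2 := by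
  simp only [HsNorm_sq]
  rw [← Summable.tsum_finsetSum fun i _ => (hf.euclidean_apply i).2]
  refine tsum_congr fun n => ?_
  rw [← Finset.mul_sum, EuclideanSpace.norm_sq_eq]
  simp only [fourierCoeff_euclidean_apply hf.1]

/-- The algebra constant for scalar functions also bounds products of a scalar function with a
Euclidean-valued one. -/
theorem HsNorm_smul_le (hℓ : 1 ≤ ℓ) {C : ℝ} (hC : 0 ≤ C)
    (hCalg : ∀ f g : AddCircle T → ℂ, MemHs T ℓ f → MemHs T ℓ g →
      HsNorm T ℓ (fun t => f t * g t) ≤ C * HsNorm T ℓ f * HsNorm T ℓ g)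
    {g : AddCircle T → ℂ} (hg : MemHs T ℓ g) (hf : MemHs T ℓ f) :
    HsNorm T ℓ (fun t => g t • f t) ≤ C * (HsNorm T ℓ g * HsNorm T ℓ f) := by
  refine (sq_le_sq₀ (HsNorm_nonneg _)
    (mul_nonneg hC (mul_nonneg (HsNorm_nonneg _) (HsNorm_nonneg _)))).1 ?_
  rw [← (hg.smul hℓ hf).sum_sq_HsNorm_apply, mul_pow, mul_pow, ← hf.sum_sq_HsNorm_apply,
    Finset.mul_sum, Finset.mul_sum]
  refine Finset.sum_le_sum fun i _ => ?_
  rw [← mul_pow, ← mul_pow, ← mul_assoc]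
  exact pow_le_pow_left₀ (HsNorm_nonneg _) (hCalg _ _ hg (hf.euclidean_apply i)) 2

end Sobolev

section MultiIndex

/-- Vandermonde's identity for multi-indices. -/
theorem sum_antidiagonalTuple_prod_choose (d : ℕ) (γ : Fin d → ℕ) (a : ℕ) :
    ∑ α ∈ Finset.Nat.antidiagonalTuple d a, ∏ i, (γ i).choose (α i) = (∑ i, γ i).choose a := by
  classical
  have key : ∀ s : Finset (Fin d), ∀ a : ℕ,
      ∑ α ∈ s.piAntidiag a, ∏ i ∈ s, (γ i).choose (α i) = (∑ i ∈ s, γ i).choose a := by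
    intro s
    induction s using Finset.induction_on with
    | empty =>
      intro a
      cases a <;> simp
    | insert i s hi ih =>
      intro a
      rw [Finset.sum_insert hi, Nat.add_choose_eq, ← Finset.cons_eq_insert _ _ hi,
        Finset.piAntidiag_cons hi,
        Finset.sum_disjiUnion]
      refine Finset.sum_congr rfl fun x hx => ?_
      rw [Finset.sum_map, ← ih, Finset.mul_sum]
      refine Finset.sum_congr rfl fun β hβ => ?_
      have h0 : β i = 0 := by
        by_contra h
        exact hi ((Finset.mem_piAntidiag.1 hβ).2 i h)
      rw [Finset.prod_cons]
      simp [h0]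
      left
      refine Finset.prod_congr rfl fun j hj => ?_
      have : j ≠ i := fun h => hi (h ▸ hj)
      simp [this]
  rw [← Finset.piAntidiag_univ_fin_eq_antidiagonalTuple, key]

/-- Vandermonde's identity for multi-indices, in terms of factorials. -/
theorem sum_inv_factorial_mul (d a b : ℕ) (γ : Fin d → ℕ) (hγ : ∑ i, γ i = a + b) :
    ∑ ab ∈ (Finset.Nat.antidiagonalTuple d a ×ˢ Finset.Nat.antidiagonalTuple d b).filter
        (fun ab => ab.1 + ab.2 = γ),
      (((∏ i, (ab.1 i).factorial : ℕ) : ℝ) * ((∏ i, (ab.2 i).factorial : ℕ) : ℝ))⁻¹ =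
    ((a + b).factorial : ℝ) / (a.factorial * b.factorial * (∏ i, (γ i).factorial : ℕ)) := by
  have hne : ((∏ i, (γ i).factorial : ℕ) : ℝ) ≠ 0 := by
    exact_mod_cast Finset.prod_ne_zero_iff.2 fun i _ => Nat.factorial_ne_zero _
  have h1 : ∑ ab ∈ (Finset.Nat.antidiagonalTuple d a ×ˢ
        Finset.Nat.antidiagonalTuple d b).filter (fun ab => ab.1 + ab.2 = γ),
      ((∏ i, (γ i).factorial : ℕ) : ℝ) *
      (((∏ i, (ab.1 i).factorial : ℕ) : ℝ) * ((∏ i, (ab.2 i).factorial : ℕ) : ℝ))⁻¹ =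
      ∑ α ∈ Finset.Nat.antidiagonalTuple d a, ((∏ i, (γ i).choose (α i) : ℕ) : ℝ) := by
    refine Finset.sum_of_injOn Prod.fst ?_ ?_ ?_ ?_
    · rintro ⟨x, y⟩ hx ⟨x', y'⟩ hx' h
      simp only [Finset.coe_filter, Set.mem_ofPred_eq] at hx hx' h
      subst h
      have := add_left_cancel (hx.2.trans hx'.2.symm)
      rw [this]
    · rintro ⟨x, y⟩ hx
      simp only [Finset.coe_filter, Set.mem_ofPred_eq, Finset.mem_product] at hx
      exact hx.1.1
    · intro α hα hn
      by_contra hc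
      have hc' : ∀ i, α i ≤ γ i := by
        intro i
        by_contra hlt
        apply hc
        rw [Finset.prod_eq_zero (Finset.mem_univ i) (Nat.choose_eq_zero_of_lt (not_le.1 hlt))]
        simp
      apply hn
      refine ⟨(α, γ - α), ?_, rfl⟩
      have h2 : α + (γ - α) = γ := add_tsub_cancel_of_le hc'
      have h3 : ∑ i, α i = a := Finset.Nat.mem_antidiagonalTuple.1 hα
      have h4 : ∑ i, (α + (γ - α)) i = a + b := by rw [h2, hγ]
      simp only [Pi.add_apply, Finset.sum_add_distrib, h3] at h4
      simp only [Finset.coe_filter, Set.mem_ofPred_eq, Finset.mem_product]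
      exact ⟨⟨hα, Finset.Nat.mem_antidiagonalTuple.2 (by omega)⟩, h2⟩
    · rintro ⟨x, y⟩ hx
      simp only [Finset.mem_filter, Finset.mem_product] at hx
      obtain ⟨-, rfl⟩ := hx
      push_cast
      rw [← Finset.prod_mul_distrib, ← Finset.prod_inv_distrib, ← Finset.prod_mul_distrib]
      refine Finset.prod_congr rfl fun i _ => ?_
      rw [Pi.add_apply, Nat.cast_add_choose, div_eq_mul_inv]
  rw [← Finset.mul_sum] at h1
  rw [← Nat.cast_sum, sum_antidiagonalTuple_prod_choose, hγ, Nat.cast_add_choose] at h1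
  field_simp at h1 ⊢
  linarith

theorem sum_sq_div_factorial (d k p : ℕ) (γ : Fin d → ℕ) (hγ : ∑ i, γ i = k + p) :
    ∑ j : Fin d, ∑ ab ∈ (Finset.Nat.antidiagonalTuple d (k + 1) ×ˢ
        Finset.Nat.antidiagonalTuple d p).filter (fun ab => ab.1 + ab.2 = γ + Pi.single j 1),
      (ab.1 j : ℝ) ^ 2 *
        (((∏ i, (ab.1 i).factorial : ℕ) : ℝ) * ((∏ i, (ab.2 i).factorial : ℕ) : ℝ))⁻¹ =
    (k + d) * (((k + p).factorial : ℝ) /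
      (k.factorial * p.factorial * (∏ i, (γ i).factorial : ℕ))) := by
  rw [← sum_inv_factorial_mul d k p γ hγ, Finset.mul_sum]
  have h1 : ∀ j : Fin d, ∑ ab ∈ (Finset.Nat.antidiagonalTuple d (k + 1) ×ˢ
        Finset.Nat.antidiagonalTuple d p).filter (fun ab => ab.1 + ab.2 = γ + Pi.single j 1),
      (ab.1 j : ℝ) ^ 2 *
        (((∏ i, (ab.1 i).factorial : ℕ) : ℝ) * ((∏ i, (ab.2 i).factorial : ℕ) : ℝ))⁻¹ =
      ∑ ab ∈ (Finset.Nat.antidiagonalTuple d k ×ˢ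
        Finset.Nat.antidiagonalTuple d p).filter (fun ab => ab.1 + ab.2 = γ),
      ((ab.1 j : ℝ) + 1) *
        (((∏ i, (ab.1 i).factorial : ℕ) : ℝ) * ((∏ i, (ab.2 i).factorial : ℕ) : ℝ))⁻¹ := by
    intro j
    symm
    refine Finset.sum_of_injOn (fun ab => (ab.1 + Pi.single j 1, ab.2)) ?_ ?_ ?_ ?_
    · rintro ⟨x, y⟩ - ⟨x', y'⟩ - h
      simpa using h
    · rintro ⟨x, y⟩ hx
      simp only [Finset.coe_filter, Set.mem_ofPred_eq, Finset.mem_product,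
        Finset.Nat.mem_antidiagonalTuple] at hx ⊢
      refine ⟨⟨?_, hx.1.2⟩, ?_⟩
      · simp [Finset.sum_add_distrib, hx.1.1]
      · rw [← hx.2]; abel
    · rintro ⟨x, y⟩ hx hn
      simp only [Finset.mem_filter, Finset.mem_product,
        Finset.Nat.mem_antidiagonalTuple] at hx
      by_contra hc
      have hxj : x j ≠ 0 := by
        intro h
        apply hc
        simp [h]
      have hle : Pi.single j 1 ≤ x := by
        intro i
        by_cases hi : i = j
        · subst hi; simp; omega
        · simp [hi]
      have h2 : x - Pi.single j 1 + Pi.single j 1 = x := tsub_add_cancel_of_le hle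
      apply hn
      refine ⟨(x - Pi.single j 1, y), ?_, by simp only [h2]⟩
      simp only [Finset.coe_filter, Set.mem_ofPred_eq, Finset.mem_product,
        Finset.Nat.mem_antidiagonalTuple]
      have h3 := hx.1.1
      rw [← h2] at h3
      simp only [Pi.add_apply, Finset.sum_add_distrib, Finset.sum_pi_single', Finset.mem_univ,
        if_true] at h3
      refine ⟨⟨by simpa using h3, hx.1.2⟩, ?_⟩
      have h4 := hx.2
      rw [← h2] at h4
      exact add_right_cancel ((add_right_comm _ _ _).trans h4)
    · rintro ⟨x, y⟩ -
      have h5 : ∏ i, ((x + Pi.single j 1 : Fin d → ℕ) i).factorial =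
          (x j + 1) * ∏ i, (x i).factorial := by
        rw [← Finset.mul_prod_erase _ _ (Finset.mem_univ j),
          ← Finset.mul_prod_erase _ (fun i => (x i).factorial) (Finset.mem_univ j)]
        rw [Finset.prod_congr rfl (g := fun i => (x i).factorial)]
        · simp [Nat.factorial_succ, mul_assoc]
        · intro i hi
          simp [Finset.ne_of_mem_erase hi]
      simp only [h5]
      have hne : ((∏ i, (x i).factorial : ℕ) : ℝ) ≠ 0 := by
        exact_mod_cast Finset.prod_ne_zero_iff.2 fun i _ => Nat.factorial_ne_zero _
      have hne' : ((∏ i, (y i).factorial : ℕ) : ℝ) ≠ 0 := by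
        exact_mod_cast Finset.prod_ne_zero_iff.2 fun i _ => Nat.factorial_ne_zero _
      have : (x j : ℝ) + 1 ≠ 0 := by positivity
      simp only [Pi.add_apply, Pi.single_eq_same]
      rw [Nat.cast_mul]
      push_cast at *
      field_simp
  rw [Finset.sum_congr rfl fun j _ => h1 j, Finset.sum_comm]
  refine Finset.sum_congr rfl fun ab hab => ?_
  rw [← Finset.sum_mul]
  congr 1
  have h2 := (Finset.Nat.mem_antidiagonalTuple.1
    (Finset.mem_product.1 (Finset.mem_filter.1 hab).1).1)
  rw [Finset.sum_add_distrib, ← Nat.cast_sum, h2]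
  simp

theorem sq_sum_mul_le {ι : Type*} (s : Finset ι) (w x y : ι → ℝ) (hw : ∀ i ∈ s, 0 < w i) :
    (∑ i ∈ s, x i * y i) ^ 2 ≤ (∑ i ∈ s, x i ^ 2 * (w i)⁻¹) * ∑ i ∈ s, w i * y i ^ 2 := by
  refine Finset.sum_sq_le_sum_mul_sum_of_sq_le_mul s (fun i hi => ?_) (fun i hi => ?_)
    (fun i hi => ?_)
  · have := hw i hi; positivity
  · have := hw i hi; positivity
  · have := (hw i hi).ne'
    exact le_of_eq (by field_simp)

/-- The weighted Cauchy–Schwarz estimate for the coefficients of a directional derivative. -/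
theorem sum_weighted_sq_le (d k p : ℕ) (a : (Fin d → ℕ) → ℝ) (b : (Fin d → ℕ) → Fin d → ℝ) :
    ∑ γ ∈ Finset.Nat.antidiagonalTuple d (k + p),
        ((∏ i, (γ i).factorial : ℕ) : ℝ) / ((k + p).factorial : ℝ) *
          (∑ j : Fin d, ∑ ab ∈ (Finset.Nat.antidiagonalTuple d (k + 1) ×ˢ
              Finset.Nat.antidiagonalTuple d p).filter
                (fun ab => ab.1 + ab.2 = γ + Pi.single j 1),
            (ab.1 j : ℝ) * (b ab.2 j * a ab.1)) ^ 2 ≤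
      ((k + 1 : ℕ) : ℝ) ^ 2 * d *
        ((∑ α ∈ Finset.Nat.antidiagonalTuple d (k + 1),
            ((∏ i, (α i).factorial : ℕ) : ℝ) / ((k + 1).factorial : ℝ) * a α ^ 2) *
         (∑ β ∈ Finset.Nat.antidiagonalTuple d p,
            ((∏ i, (β i).factorial : ℕ) : ℝ) / (p.factorial : ℝ) * ∑ j, b β j ^ 2)) := by
  have hpos : ∀ x : Fin d → ℕ, (0 : ℝ) < ((∏ i, (x i).factorial : ℕ) : ℝ) := fun x => by
    exact_mod_cast Finset.prod_pos fun i _ => Nat.factorial_pos _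
  set A := Finset.Nat.antidiagonalTuple d (k + 1)
  set B := Finset.Nat.antidiagonalTuple d p
  let W : (Fin d → ℕ) × (Fin d → ℕ) → Fin d → ℝ := fun ab j =>
    ((∏ i, (ab.1 i).factorial : ℕ) : ℝ) * ((∏ i, (ab.2 i).factorial : ℕ) : ℝ) *
      (b ab.2 j * a ab.1) ^ 2
  have hW : ∀ ab j, 0 ≤ W ab j := fun ab j =>
    mul_nonneg (mul_nonneg (hpos _).le (hpos _).le) (sq_nonneg _)
  have step : ∀ γ ∈ Finset.Nat.antidiagonalTuple d (k + p),
      ((∏ i, (γ i).factorial : ℕ) : ℝ) / ((k + p).factorial : ℝ) *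
          (∑ j : Fin d, ∑ ab ∈ (A ×ˢ B).filter (fun ab => ab.1 + ab.2 = γ + Pi.single j 1),
            (ab.1 j : ℝ) * (b ab.2 j * a ab.1)) ^ 2 ≤
      ((k + d) / (k.factorial * p.factorial)) *
        ∑ j : Fin d, ∑ ab ∈ (A ×ˢ B).filter (fun ab => ab.1 + ab.2 = γ + Pi.single j 1),
          W ab j := by
    intro γ hγ
    have h1 := sum_sq_div_factorial d k p γ (Finset.Nat.mem_antidiagonalTuple.1 hγ)
    have h2 := sq_sum_mul_le
      (Finset.univ.sigma fun j : Fin d =>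
        (A ×ˢ B).filter (fun ab => ab.1 + ab.2 = γ + Pi.single j 1))
      (fun x => ((∏ i, (x.2.1 i).factorial : ℕ) : ℝ) * ((∏ i, (x.2.2 i).factorial : ℕ) : ℝ))
      (fun x => (x.2.1 x.1 : ℝ)) (fun x => b x.2.2 x.1 * a x.2.1)
      (fun x _ => mul_pos (hpos _) (hpos _))
    simp only [Finset.sum_sigma] at h2
    rw [h1] at h2
    calc _ ≤ ((∏ i, (γ i).factorial : ℕ) : ℝ) / ((k + p).factorial : ℝ) * _ :=
          mul_le_mul_of_nonneg_left h2 (div_nonneg (hpos _).le (by positivity))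
      _ = _ := by
          have := (hpos γ).ne'
          have h4 : ((k + p).factorial : ℝ) ≠ 0 := by positivity
          have h5 : (k.factorial : ℝ) ≠ 0 := by positivity
          have h6 : (p.factorial : ℝ) ≠ 0 := by positivity
          simp only [W]
          generalize ((∏ i, (γ i).factorial : ℕ) : ℝ) = g at *
          field_simp
  refine (Finset.sum_le_sum step).trans ?_
  rw [← Finset.mul_sum, Finset.sum_comm]
  have h3 : ∀ j : Fin d, ∑ γ ∈ Finset.Nat.antidiagonalTuple d (k + p),
      ∑ ab ∈ (A ×ˢ B).filter (fun ab => ab.1 + ab.2 = γ + Pi.single j 1), W ab j ≤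
      ∑ ab ∈ A ×ˢ B, W ab j := by
    intro j
    simp_rw [Finset.sum_filter]
    rw [Finset.sum_comm]
    refine Finset.sum_le_sum fun ab _ => ?_
    calc _ ≤ ∑ γ ∈ Finset.Nat.antidiagonalTuple d (k + p),
          if ab.1 + ab.2 - Pi.single j 1 = γ then W ab j else 0 := by
          refine Finset.sum_le_sum fun γ _ => ?_
          by_cases h : ab.1 + ab.2 = γ + Pi.single j 1
          · rw [if_pos h, if_pos (by rw [h, add_tsub_cancel_right])]
          · rw [if_neg h]
            split_ifs
            exacts [hW _ _, le_rfl]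
      _ ≤ W ab j := by
          rw [Finset.sum_ite_eq]
          split_ifs
          exacts [le_rfl, hW _ _]
  have h4 : ∑ j : Fin d, ∑ ab ∈ A ×ˢ B, W ab j =
      (∑ α ∈ A, ((∏ i, (α i).factorial : ℕ) : ℝ) * a α ^ 2) *
        ∑ β ∈ B, ((∏ i, (β i).factorial : ℕ) : ℝ) * ∑ j, b β j ^ 2 := by
    rw [Finset.sum_comm, Finset.sum_mul_sum, Finset.sum_product]
    refine Finset.sum_congr rfl fun α _ => Finset.sum_congr rfl fun β _ => ?_
    simp only [W, mul_pow, ← Finset.mul_sum, ← Finset.sum_mul]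
    ring
  have hcoef : ((k : ℝ) + d) / (k.factorial * p.factorial) ≤
      ((k + 1 : ℕ) : ℝ) ^ 2 * d / ((k + 1).factorial * p.factorial) ∨ d = 0 := by
    rcases Nat.eq_zero_or_pos d with h | h
    · exact Or.inr h
    left
    have hd : (1 : ℝ) ≤ d := by exact_mod_cast h
    have h5 : (0 : ℝ) < k.factorial := by positivity
    have h6 : (0 : ℝ) < p.factorial := by positivity
    rw [Nat.factorial_succ]
    push_cast
    have : ((k : ℝ) + 1) ^ 2 * d / ((k + 1) * k.factorial * p.factorial) =
        ((k + 1) * d) / (k.factorial * p.factorial) := by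
      field_simp
    rw [this]
    gcongr
    nlinarith [(Nat.cast_nonneg k : (0 : ℝ) ≤ k)]
  have hR : ((k + 1 : ℕ) : ℝ) ^ 2 * d *
        ((∑ α ∈ A, ((∏ i, (α i).factorial : ℕ) : ℝ) / ((k + 1).factorial : ℝ) * a α ^ 2) *
         (∑ β ∈ B, ((∏ i, (β i).factorial : ℕ) : ℝ) / (p.factorial : ℝ) * ∑ j, b β j ^ 2)) =
      ((k + 1 : ℕ) : ℝ) ^ 2 * d / ((k + 1).factorial * p.factorial) *
        ∑ j : Fin d, ∑ ab ∈ A ×ˢ B, W ab j := by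
    rw [h4]
    simp_rw [div_mul_eq_mul_div, ← Finset.sum_div]
    field_simp
  rw [hR]
  rcases hcoef with hcoef | rfl
  · exact mul_le_mul hcoef (Finset.sum_le_sum fun j _ => h3 j)
      (Finset.sum_nonneg fun j _ => Finset.sum_nonneg fun γ _ =>
        Finset.sum_nonneg fun ab _ => hW _ _)
      (by positivity)
  · simp

end MultiIndex

/-- for `Φ_k` homogeneous of degree `k` with coefficients `φ_α ∈ H^ℓ(ℝ/Tℤ,ℝ^m)`
and `N_p` homogeneous of degree `p` with coefficients `ν_β ∈ H^ℓ(ℝ/Tℤ,ℝ^{m₀})`, the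
directional derivative `D_XΦ_k·N_p` (a homogeneous polynomial of degree `k−1+p` whose
coefficient at `γ` is `Σ_j Σ_{α+β=γ+σ_j} α_j ν_{β,j} φ_α`) satisfies
`‖D_XΦ_k·N_p‖_{k−1+p} ≤ C k √m₀ ‖Φ_k‖_k ‖N_p‖_p`, with `C` the algebra constant. -/
theorem stmt6 (T : ℝ) [Fact (0 < T)] (ℓ m m₀ k p : ℕ) (hℓ : 1 ≤ ℓ) (C : ℝ) (hC : 0 < C)
    (hCalg : ∀ f g : AddCircle T → ℂ, MemHs T ℓ f → MemHs T ℓ g →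
      HsNorm T ℓ (fun t => f t * g t) ≤ C * HsNorm T ℓ f * HsNorm T ℓ g)
    (φ : (Fin m₀ → ℕ) → AddCircle T → EuclideanSpace ℂ (Fin m))
    (hφ : ∀ α ∈ Finset.Nat.antidiagonalTuple m₀ k, MemHs T ℓ (φ α))
    (ν : (Fin m₀ → ℕ) → AddCircle T → EuclideanSpace ℂ (Fin m₀))
    (hν : ∀ β ∈ Finset.Nat.antidiagonalTuple m₀ p, MemHs T ℓ (ν β)) :
    Real.sqrt (∑ γ ∈ Finset.Nat.antidiagonalTuple m₀ (k - 1 + p),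
        ((∏ i, (γ i).factorial : ℕ) : ℝ) / ((k - 1 + p).factorial : ℝ) *
          HsNorm T ℓ (fun t => ∑ j : Fin m₀,
            ∑ ab ∈ (Finset.Nat.antidiagonalTuple m₀ k ×ˢ
                Finset.Nat.antidiagonalTuple m₀ p).filter
                  (fun ab => ab.1 + ab.2 = γ + Pi.single j 1),
              ((ab.1 j : ℕ) : ℂ) • (ν ab.2 t j • φ ab.1 t)) ^ 2) ≤
      C * k * Real.sqrt m₀ *
        (Real.sqrt (∑ α ∈ Finset.Nat.antidiagonalTuple m₀ k,
            ((∏ i, (α i).factorial : ℕ) : ℝ) / (k.factorial : ℝ) * HsNorm T ℓ (φ α) ^ 2) *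
         Real.sqrt (∑ β ∈ Finset.Nat.antidiagonalTuple m₀ p,
            ((∏ i, (β i).factorial : ℕ) : ℝ) / (p.factorial : ℝ) * HsNorm T ℓ (ν β) ^ 2)) := by
  have hsum : ∀ γ : Fin m₀ → ℕ,
      HsNorm T ℓ (fun t => ∑ j : Fin m₀,
        ∑ ab ∈ (Finset.Nat.antidiagonalTuple m₀ k ×ˢ
            Finset.Nat.antidiagonalTuple m₀ p).filter
              (fun ab => ab.1 + ab.2 = γ + Pi.single j 1),
          ((ab.1 j : ℕ) : ℂ) • (ν ab.2 t j • φ ab.1 t)) ≤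
      C * ∑ j : Fin m₀,
        ∑ ab ∈ (Finset.Nat.antidiagonalTuple m₀ k ×ˢ
            Finset.Nat.antidiagonalTuple m₀ p).filter
              (fun ab => ab.1 + ab.2 = γ + Pi.single j 1),
          (ab.1 j : ℝ) * (HsNorm T ℓ (fun t => ν ab.2 t j) * HsNorm T ℓ (φ ab.1)) := by
    intro γ
    set s : Finset ((_ : Fin m₀) × (Fin m₀ → ℕ) × (Fin m₀ → ℕ)) := Finset.univ.sigma fun j =>
      (Finset.Nat.antidiagonalTuple m₀ k ×ˢ Finset.Nat.antidiagonalTuple m₀ p).filter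
        (fun ab => ab.1 + ab.2 = γ + Pi.single j 1) with hs
    have hmem : ∀ x ∈ s, MemHs T ℓ (ν x.2.2) ∧ MemHs T ℓ (φ x.2.1) := by
      intro x hx
      have h := Finset.mem_product.1 (Finset.mem_filter.1 (Finset.mem_sigma.1 hx).2).1
      exact ⟨hν _ h.2, hφ _ h.1⟩
    have h1 := HsNorm_sum_smul_le s (fun x => ((x.2.1 x.1 : ℕ) : ℂ))
      (f := fun x t => ν x.2.2 t x.1 • φ x.2.1 t)
      fun x hx => ((hmem x hx).1.euclidean_apply x.1).smul hℓ (hmem x hx).2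
    have h2 : ∑ x ∈ s, ‖((x.2.1 x.1 : ℕ) : ℂ)‖ *
          HsNorm T ℓ (fun t => ν x.2.2 t x.1 • φ x.2.1 t) ≤
        C * ∑ x ∈ s, (x.2.1 x.1 : ℝ) *
          (HsNorm T ℓ (fun t => ν x.2.2 t x.1) * HsNorm T ℓ (φ x.2.1)) := by
      rw [Finset.mul_sum]
      refine Finset.sum_le_sum fun x hx => ?_
      rw [Complex.norm_natCast, mul_left_comm]
      exact mul_le_mul_of_nonneg_left (HsNorm_smul_le hℓ hC.le hCalg
        ((hmem x hx).1.euclidean_apply x.1) (hmem x hx).2) (Nat.cast_nonneg _)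
    have h3 := h1.trans h2
    simpa only [hs, Finset.sum_sigma] using h3
  rw [← Real.sqrt_mul (Finset.sum_nonneg fun α _ => by positivity)]
  refine Real.sqrt_le_iff.2 ⟨by positivity, ?_⟩
  rw [mul_pow, mul_pow, mul_pow, Real.sq_sqrt (Nat.cast_nonneg _), Real.sq_sqrt (mul_nonneg
    (Finset.sum_nonneg fun α _ => by positivity) (Finset.sum_nonneg fun β _ => by positivity))]
  have hle : ∀ γ ∈ Finset.Nat.antidiagonalTuple m₀ (k - 1 + p), _ := fun γ _ =>
    mul_le_mul_of_nonneg_left (pow_le_pow_left₀ (HsNorm_nonneg _) (hsum γ) 2)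
      (show 0 ≤ ((∏ i, (γ i).factorial : ℕ) : ℝ) / ((k - 1 + p).factorial : ℝ) by positivity)
  refine (Finset.sum_le_sum hle).trans ?_
  simp only [mul_pow, mul_left_comm _ (C ^ 2), ← Finset.mul_sum]
  rw [mul_assoc, mul_assoc]
  refine mul_le_mul_of_nonneg_left ?_ (sq_nonneg C)
  rcases k with _ | k
  · have h0 : ∀ x ∈ Finset.Nat.antidiagonalTuple m₀ 0, x = 0 := fun x hx => by
      simpa [Finset.Nat.antidiagonalTuple_zero_right] using hx
    refine le_of_eq_of_le (Finset.sum_eq_zero fun γ _ => ?_) (by simp)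
    rw [Finset.sum_eq_zero fun j _ => Finset.sum_eq_zero fun ab hab => ?_]
    · simp
    · rw [h0 _ (Finset.mem_product.1 (Finset.mem_filter.1 hab).1).1]
      simp
  · have h := sum_weighted_sq_le m₀ k p (fun α => HsNorm T ℓ (φ α))
      (fun β j => HsNorm T ℓ (fun t => ν β t j))
    have hB : ∑ β ∈ Finset.Nat.antidiagonalTuple m₀ p,
          ((∏ i, (β i).factorial : ℕ) : ℝ) / (p.factorial : ℝ) *
            ∑ j, HsNorm T ℓ (fun t => ν β t j) ^ 2 =
        ∑ β ∈ Finset.Nat.antidiagonalTuple m₀ p,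
          ((∏ i, (β i).factorial : ℕ) : ℝ) / (p.factorial : ℝ) * HsNorm T ℓ (ν β) ^ 2 :=
      Finset.sum_congr rfl fun β hβ => by rw [(hν β hβ).sum_sq_HsNorm_apply]
    rw [hB, mul_assoc] at h
    exact h
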